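/- arXiv:2510.10554 — 2 statements merged into one kernel-verified Lean document; each statement's English description precedes it below -/
import Mathlib

section
/- Let β ∈ ℝ∖ℤ and let x ∈ ℂ with Re(x) > 0. Then ∫₀^∞ e^{−xt}/(1 − e^{−t} e^{2πiβ}) dt = lim_{N→∞} Σ_{q=0}^{N} e^{2πiβq}/(x+q); in particular the limit of partial sums on the right exists and the absolutely convergent integral on the left equals it. -/
open Complex MeasureTheory Filter Topology Set Asymptotics

noncomputable section

/-- `e2pi θ = e^{2πiθ}`. -/
def e2pi (θ : ℝ) : ℂ := Complex.exp (2 * Real.pi * Complex.I * θ)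

theorem e2pi_norm (β : ℝ) : ‖e2pi β‖ = 1 := by
  unfold e2pi
  rw [Complex.norm_exp]
  simp

theorem e2pi_ne_one (β : ℝ) (hβ : ∀ n : ℤ, β ≠ n) : e2pi β ≠ 1 := by
  unfold e2pi
  intro h
  obtain ⟨n, hn⟩ := Complex.exp_eq_one_iff.1 h
  apply hβ n
  have h2 : (2 * Real.pi * Complex.I : ℂ) ≠ 0 := Complex.two_pi_I_ne_zero
  have h3 : (2 * Real.pi * Complex.I : ℂ) * β = (2 * Real.pi * Complex.I : ℂ) * n := by
    rw [hn]; ring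
  exact_mod_cast mul_left_cancel₀ h2 h3

theorem e2pi_mul_nat (β : ℝ) (q : ℕ) : e2pi (β * q) = e2pi β ^ q := by
  unfold e2pi
  rw [← Complex.exp_nat_mul]
  congr 1
  push_cast
  ring

theorem den_bound (w : ℂ) (hw : ‖w‖ = 1) (t : ℝ) (ht : 0 < t) :
    ‖1 - w‖ / 2 ≤ ‖1 - Complex.exp (-(t : ℂ)) * w‖ := by
  have hr : Complex.exp (-(t : ℂ)) = ((Real.exp (-t) : ℝ) : ℂ) := by push_cast; rfl
  have h1 : Real.exp (-t) ≤ 1 := Real.exp_le_one_iff.2 (by linarith)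
  rw [hr]
  set r := Real.exp (-t) with hrdef
  have hr0 : 0 < r := Real.exp_pos _
  have hn : ‖(r : ℂ) * w‖ = r := by simp [hw, abs_of_pos hr0]
  have a1 : 1 - r ≤ ‖1 - (r : ℂ) * w‖ := by
    have := norm_sub_norm_le (1 : ℂ) ((r : ℂ) * w)
    rw [hn, norm_one] at this
    exact this
  have a2 : ‖1 - w‖ ≤ ‖1 - (r : ℂ) * w‖ + (1 - r) := by
    have e : 1 - w = (1 - (r : ℂ) * w) - ((1 - r : ℝ) : ℂ) * w := by push_cast; ring
    have := norm_sub_le (1 - (r : ℂ) * w) (((1 - r : ℝ) : ℂ) * w)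
    rw [← e, norm_mul, hw, Complex.norm_real, Real.norm_eq_abs,
      abs_of_nonneg (by linarith), mul_one] at this
    exact this
  linarith

/-- The integral `ψ_β(x) = ∫₀^∞ e^{-xt}/(1 - e^{-t}e^{2πiβ}) dt` converges absolutely for
`Re x > 0`, `β ∉ ℤ`, and equals the limit of the partial sums of `∑_{q≥0} e^{2πiβq}/(x+q)`. -/
theorem psiBeta_integral_eq_series (β : ℝ) (hβ : ∀ n : ℤ, β ≠ n) (x : ℂ) (hx : 0 < x.re) :
    IntegrableOn
      (fun t : ℝ => Complex.exp (-x * t) / (1 - Complex.exp (-(t : ℂ)) * e2pi β))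
      (Set.Ioi 0) ∧
    Tendsto (fun N : ℕ => ∑ q ∈ Finset.range (N + 1), e2pi (β * q) / (x + q)) atTop
      (𝓝 (∫ t in Set.Ioi (0 : ℝ),
        Complex.exp (-x * t) / (1 - Complex.exp (-(t : ℂ)) * e2pi β))) := by
  have hw := e2pi_norm β
  have hw1 := e2pi_ne_one β hβ
  simp_rw [e2pi_mul_nat]
  generalize e2pi β = w at hw hw1
  have hc : 0 < ‖1 - w‖ / 2 := by
    have : 0 < ‖1 - w‖ := norm_pos_iff.2 (sub_ne_zero.2 hw1.symm)
    linarith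
  set c := ‖1 - w‖ / 2 with hcdef
  have hden : ∀ t : ℝ, 0 < t → c ≤ ‖1 - Complex.exp (-(t : ℂ)) * w‖ := den_bound w hw
  have hne : ∀ t : ℝ, 0 < t → 1 - Complex.exp (-(t : ℂ)) * w ≠ 0 := fun t ht =>
    norm_pos_iff.1 (hc.trans_le (hden t ht))
  have hz : ∀ t : ℝ, 0 < t → ‖Complex.exp (-(t : ℂ)) * w‖ < 1 := by
    intro t ht
    rw [norm_mul, hw, mul_one, Complex.norm_exp]
    simpa using ht
  have hexp : ∀ t : ℝ, ‖Complex.exp (-x * t)‖ = Real.exp (-x.re * t) := by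
    intro t
    rw [Complex.norm_exp]
    simp
  have hb : IntegrableOn (fun t : ℝ => Real.exp (-x.re * t) * (2 / c)) (Set.Ioi 0) :=
    (integrableOn_exp_mul_Ioi (by linarith) 0).mul_const _
  have hmeas : AEStronglyMeasurable
      (fun t : ℝ => Complex.exp (-x * t) / (1 - Complex.exp (-(t : ℂ)) * w))
      (volume.restrict (Set.Ioi 0)) := by
    apply Measurable.aestronglyMeasurable
    fun_prop
  refine ⟨?_, ?_⟩
  · refine Integrable.mono' hb hmeas ?_
    filter_upwards [ae_restrict_mem measurableSet_Ioi] with t ht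
    rw [norm_div, hexp, div_eq_mul_inv]
    gcongr
    rw [inv_eq_one_div]
    exact div_le_div₀ (by norm_num) (by norm_num) hc (hden t ht)
  · have hterm : ∀ q : ℕ, (-(x + q)).re < 0 := by
      intro q
      have : (0 : ℝ) ≤ q := Nat.cast_nonneg q
      simp
      linarith
    have hsum : ∀ N : ℕ, ∑ q ∈ Finset.range (N + 1), w ^ q / (x + q) =
        ∫ t in Set.Ioi (0 : ℝ), ∑ q ∈ Finset.range (N + 1),
          w ^ q * Complex.exp (-(x + q) * t) := by
      intro N
      rw [integral_finsetSum]
      · refine Finset.sum_congr rfl fun q _ => ?_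
        rw [integral_const_mul, integral_exp_mul_complex_Ioi (hterm q) 0]
        rw [Complex.ofReal_zero, mul_zero, Complex.exp_zero, neg_div_neg_eq, mul_one_div]
      · intro q _
        exact (integrableOn_exp_mul_complex_Ioi (hterm q) 0).const_mul _
    have hgeom : ∀ N : ℕ, ∀ t : ℝ, 0 < t → ∑ q ∈ Finset.range (N + 1),
          w ^ q * Complex.exp (-(x + q) * t) =
        Complex.exp (-x * t) * (1 - (Complex.exp (-(t : ℂ)) * w) ^ (N + 1)) /
          (1 - Complex.exp (-(t : ℂ)) * w) := by
      intro N t ht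
      rw [eq_div_iff (hne t ht), ← geom_sum_mul_neg, ← mul_assoc, Finset.mul_sum]
      congr 1
      refine Finset.sum_congr rfl fun q _ => ?_
      rw [mul_pow, ← Complex.exp_nat_mul, ← mul_assoc, ← Complex.exp_add, mul_comm]
      congr 2
      ring
    simp_rw [hsum]
    refine tendsto_integral_of_dominated_convergence
      (fun t : ℝ => Real.exp (-x.re * t) * (2 / c)) ?_ hb ?_ ?_
    · intro N
      apply Measurable.aestronglyMeasurable
      fun_prop
    · intro N
      filter_upwards [ae_restrict_mem measurableSet_Ioi] with t ht
      rw [hgeom N t ht, mul_div_assoc, norm_mul, hexp, norm_div]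
      gcongr
      · have h1 := norm_sub_le (1 : ℂ) ((Complex.exp (-(t : ℂ)) * w) ^ (N + 1))
        rw [norm_pow, norm_one] at h1
        have h2 := pow_le_one₀ (n := N + 1) (norm_nonneg _) (hz t ht).le
        linarith
      · exact hden t ht
    · filter_upwards [ae_restrict_mem measurableSet_Ioi] with t ht
      have h0 := (tendsto_pow_atTop_nhds_zero_of_norm_lt_one (hz t ht)).comp (tendsto_add_atTop_nat 1)
      have h1 := ((h0.const_sub 1).const_mul (Complex.exp (-x * t))).div_const
        (1 - Complex.exp (-(t : ℂ)) * w)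
      rw [sub_zero, mul_one] at h1
      refine h1.congr fun N => ?_
      rw [hgeom N t ht]
      rfl

end
end

section
/- Let k ≥ 3 be an integer, α, β ∈ ℝ∖ℤ, and x ∈ ℂ with Re(x) > 0. Define G_{m,n}(x, α, β) := (−x)^n · ∫₀^∞ Li_{m,n}(e^{−xt} e^{2πiα}, e^{−t} e^{2πiβ}) dt and F_k(y, α', β') := −y · ∫₀^∞ Li_{k−2}(e^{−yt} e^{2πiα'}) · Li₁(e^{−t} e^{2πiβ'}) dt. Then G_{k−2,1}(x, α, β) = F_k(x+1, α+β, β) + Li_{k−1}(e^{2πi(α+β)}) · Li₁(e^{2πiβ}) − Li_{k−1,1}(e^{2πiα}, e^{2πiβ}). -/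
open Complex MeasureTheory Filter Topology Set Asymptotics

noncomputable section

/-- Polylogarithm of integer order: `Li 0 z = z/(1-z)`, `Li 1 z = -Log(1-z)`,
`Li m z = ∑_{n≥1} z^n/n^m` for `m ≥ 2`. -/
def Li : ℕ → ℂ → ℂ
  | 0, z => z / (1 - z)
  | 1, z => -Complex.log (1 - z)
  | (m+2), z => ∑' n : ℕ, z ^ (n+1) / ((n+1 : ℕ) : ℂ) ^ (m+2)

/-- The double polylogarithm `Li_{a,b}(z₁,z₂) = ∑_{0<p<q} z₁^p z₂^q/(p^a q^b)`, as an iterated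
sum whose inner series is summed as the limit of its partial sums. -/
def Li2 (a b : ℕ) (z₁ z₂ : ℂ) : ℂ :=
  ∑' p : ℕ, (z₁ ^ (p + 1) / ((p + 1 : ℕ) : ℂ) ^ a) *
    limUnder atTop (fun N : ℕ => ∑ q ∈ Finset.Icc (p + 2) N, z₂ ^ q / ((q : ℕ) : ℂ) ^ b)

/-- `G_{m,n}(x,α,β) = (-x)^n ∫₀^∞ Li_{m,n}(e^{-xt}e^{2πiα}, e^{-t}e^{2πiβ}) dt`. -/
def Gmn (m n : ℕ) (x : ℂ) (α β : ℝ) : ℂ :=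
  (-x) ^ n * ∫ t in Set.Ioi (0:ℝ),
    Li2 m n (Complex.exp (-x * t) * e2pi α) (Complex.exp (-(t : ℂ)) * e2pi β)

/-- `F_k(y,α',β') := -y ∫₀^∞ Li_{k-2}(e^{-yt}e^{2πiα'}) Li₁(e^{-t}e^{2πiβ'}) dt`. -/
def Fk (k : ℕ) (y : ℂ) (α' β' : ℝ) : ℂ :=
  -y * ∫ t in Set.Ioi (0:ℝ),
    Li (k - 2) (Complex.exp (-y * t) * e2pi α') * Li 1 (Complex.exp (-(t : ℂ)) * e2pi β')

def wf (b : ℂ) (s : ℝ) : ℂ := Complex.exp (-(s : ℂ)) * b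

def gg (b : ℂ) (n : ℕ) (s : ℝ) : ℂ := wf b s ^ n / (1 - wf b s)

def SS (b : ℂ) (n : ℕ) (t : ℝ) : ℂ := ∫ s in Ioi t, gg b n s

lemma norm_wf {b : ℂ} (hb : ‖b‖ = 1) (s : ℝ) : ‖wf b s‖ = Real.exp (-s) := by
  simp [wf, hb, Complex.norm_exp]

lemma continuous_wf (b : ℂ) : Continuous (wf b) := by
  unfold wf; fun_prop

lemma wf_ne {b : ℂ} (hb : ‖b‖ = 1) (hb1 : b ≠ 1) (s : ℝ) : 1 - wf b s ≠ 0 := by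
  intro h
  have h1 : wf b s = 1 := (sub_eq_zero.mp h).symm
  have h2 := norm_wf hb s
  rw [h1, norm_one] at h2
  have h3 : s = 0 := by
    have := (Real.exp_eq_one_iff _).mp h2.symm
    linarith
  subst h3
  simp [wf] at h1
  exact hb1 h1

lemma continuous_gg {b : ℂ} (hb : ‖b‖ = 1) (hb1 : b ≠ 1) (n : ℕ) : Continuous (gg b n) := by
  unfold gg
  exact ((continuous_wf b).pow n).div (continuous_const.sub (continuous_wf b)) (wf_ne hb hb1)

lemma exists_kappa {b : ℂ} (hb : ‖b‖ = 1) (hb1 : b ≠ 1) :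
    ∃ K : ℝ, 0 < K ∧ ∀ s : ℝ, 0 ≤ s → ‖(1 - wf b s)⁻¹‖ ≤ K := by
  have hc : Continuous (fun r : ℝ => ‖1 - (r : ℂ) * b‖) := by fun_prop
  obtain ⟨r, hr, hmin⟩ := (isCompact_Icc (a := (0:ℝ)) (b := 1)).exists_isMinOn
    ⟨0, by simp⟩ hc.continuousOn
  have hpos : 0 < ‖1 - (r : ℂ) * b‖ := by
    rw [norm_pos_iff]
    intro h
    have h1 : (r : ℂ) * b = 1 := (sub_eq_zero.mp h).symm
    have h2 : ‖(r : ℂ) * b‖ = 1 := by rw [h1, norm_one]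
    rw [norm_mul, hb, mul_one, Complex.norm_real, Real.norm_of_nonneg hr.1] at h2
    subst h2
    simp at h1
    exact hb1 h1
  refine ⟨‖1 - (r : ℂ) * b‖⁻¹, inv_pos.mpr hpos, fun s hs => ?_⟩
  rw [norm_inv]
  apply inv_anti₀ hpos
  have := hmin (a := Real.exp (-s)) ⟨(Real.exp_pos _).le, by simpa using hs⟩
  simpa [wf] using this

lemma norm_gg_le {b : ℂ} (hb : ‖b‖ = 1) {K : ℝ}
    (hK : ∀ s : ℝ, 0 ≤ s → ‖(1 - wf b s)⁻¹‖ ≤ K) (n : ℕ) {s : ℝ} (hs : 0 ≤ s) :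
    ‖gg b n s‖ ≤ K * Real.exp (-(n : ℝ) * s) := by
  rw [gg, div_eq_mul_inv, norm_mul, norm_pow, norm_wf hb, ← Real.exp_nat_mul, mul_comm,
    show (n : ℝ) * -s = -(n : ℝ) * s by ring]
  exact mul_le_mul_of_nonneg_right (hK s hs) (Real.exp_pos _).le

lemma integrableOn_gg {b : ℂ} (hb : ‖b‖ = 1) (hb1 : b ≠ 1) {n : ℕ} (hn : 1 ≤ n) (t : ℝ) :
    IntegrableOn (gg b n) (Ioi t) := by
  obtain ⟨K, hK0, hK⟩ := exists_kappa hb hb1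
  have hn' : (0 : ℝ) < n := by exact_mod_cast hn
  have h0 : IntegrableOn (gg b n) (Ioi 0) := by
    refine Integrable.mono' ((integrableOn_exp_mul_Ioi (a := -(n : ℝ)) (by linarith) 0).const_mul K)
      (continuous_gg hb hb1 n).aestronglyMeasurable ?_
    filter_upwards [ae_restrict_mem measurableSet_Ioi] with s hs
    exact norm_gg_le hb hK n (le_of_lt hs)
  have h1 : IntegrableOn (gg b n) (Icc t 0) :=
    (continuous_gg hb hb1 n).continuousOn.integrableOn_compact isCompact_Icc
  refine (h1.union h0).mono_set ?_
  intro s hs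
  rcases le_or_gt s 0 with h | h
  · exact Or.inl ⟨le_of_lt hs, h⟩
  · exact Or.inr h

lemma norm_SS_le {b : ℂ} (hb : ‖b‖ = 1) {K : ℝ}
    (hK : ∀ s : ℝ, 0 ≤ s → ‖(1 - wf b s)⁻¹‖ ≤ K) {n : ℕ} (hn : 1 ≤ n) {t : ℝ} (ht : 0 ≤ t) :
    ‖SS b n t‖ ≤ K / n := by
  have hK0 : 0 ≤ K := (norm_nonneg _).trans (hK 0 le_rfl)
  have hn' : (0 : ℝ) < n := by exact_mod_cast hn
  have h := norm_integral_le_of_norm_le (μ := volume.restrict (Ioi t)) (f := gg b n)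
    ((integrableOn_exp_mul_Ioi (a := -(n : ℝ)) (by linarith) t).const_mul K) (by
    filter_upwards [ae_restrict_mem measurableSet_Ioi] with s hs
    exact norm_gg_le hb hK n (ht.trans (le_of_lt hs)))
  rw [integral_const_mul, integral_exp_mul_Ioi (by linarith)] at h
  refine h.trans ?_
  rw [neg_div_neg_eq, ← mul_div_assoc]
  gcongr
  have : Real.exp (-(n : ℝ) * t) ≤ 1 := by
    rw [Real.exp_le_one_iff]; nlinarith
  nlinarith

lemma hasDerivAt_SS {b : ℂ} (hb : ‖b‖ = 1) (hb1 : b ≠ 1) {n : ℕ} (hn : 1 ≤ n) (t : ℝ) :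
    HasDerivAt (SS b n) (-gg b n t) t := by
  have h : SS b n = fun t => SS b n 0 - ∫ s in (0:ℝ)..t, gg b n s := by
    funext u
    have := intervalIntegral.integral_interval_add_Ioi (integrableOn_gg hb hb1 hn 0)
      (integrableOn_gg hb hb1 hn u)
    simp only [SS]
    rw [← this]; ring
  rw [h]
  exact ((continuous_gg hb hb1 n).integral_hasStrictDerivAt 0 t).hasDerivAt.const_sub _

lemma continuous_SS {b : ℂ} (hb : ‖b‖ = 1) (hb1 : b ≠ 1) {n : ℕ} (hn : 1 ≤ n) :
    Continuous (SS b n) :=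
  continuous_iff_continuousAt.mpr fun t => (hasDerivAt_SS hb hb1 hn t).continuousAt

lemma SS_sub {b : ℂ} (hb : ‖b‖ = 1) (hb1 : b ≠ 1) {n : ℕ} (hn : 1 ≤ n) (t : ℝ) :
    SS b n t - SS b (n + 1) t = wf b t ^ n / n := by
  have hn0 : (n : ℂ) ≠ 0 := by exact_mod_cast (by omega : n ≠ 0)
  have hn' : (0 : ℝ) < n := by exact_mod_cast hn
  rw [SS, SS, ← integral_sub (integrableOn_gg hb hb1 hn t)
    (integrableOn_gg hb hb1 (by omega) t)]
  have h : ∀ s, gg b n s - gg b (n + 1) s = Complex.exp (-(n : ℂ) * s) * b ^ n := by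
    intro s
    have h1 := wf_ne hb hb1 s
    have h2 : gg b n s - gg b (n + 1) s = wf b s ^ n := by
      simp only [gg]; field_simp; ring
    rw [h2, wf, mul_pow, ← Complex.exp_nat_mul]
    congr 2; ring
  simp_rw [h]
  rw [integral_mul_const, integral_exp_mul_complex_Ioi (by simpa using hn'), wf, mul_pow,
    ← Complex.exp_nat_mul, neg_div_neg_eq, show -(n : ℂ) * t = n * -(t : ℂ) by ring]
  ring

lemma limUnder_eq {b : ℂ} (hb : ‖b‖ = 1) (hb1 : b ≠ 1) (p : ℕ) {t : ℝ} (ht : 0 ≤ t) :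
    limUnder atTop (fun N : ℕ => ∑ q ∈ Finset.Icc (p + 2) N, wf b t ^ q / ((q : ℕ) : ℂ) ^ 1)
      = SS b (p + 2) t := by
  obtain ⟨K, hK0, hK⟩ := exists_kappa hb hb1
  apply Tendsto.limUnder_eq
  have h0 : Tendsto (fun N : ℕ => SS b (N + 1) t) atTop (𝓝 0) := by
    refine squeeze_zero_norm (a := fun N : ℕ => K * (1 / ((N : ℝ) + 1))) (fun N => ?_) ?_
    · have := norm_SS_le hb hK (n := N + 1) (by omega) ht
      push_cast at this
      rwa [mul_one_div]
    · simpa using (tendsto_one_div_add_atTop_nhds_zero_nat (𝕜 := ℝ)).const_mul K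
  have h1 : ∀ N : ℕ, p + 1 ≤ N →
      ∑ q ∈ Finset.Icc (p + 2) N, wf b t ^ q / ((q : ℕ) : ℂ) ^ 1
        = SS b (p + 2) t - SS b (N + 1) t := by
    intro N hN
    induction N, hN using Nat.le_induction with
    | base => simp
    | succ N hN ih =>
      rw [Finset.sum_Icc_succ_top (by omega), ih, pow_one, ← SS_sub hb hb1 (by omega) t]
      ring
  have h2 : Tendsto (fun N : ℕ => SS b (p + 2) t - SS b (N + 1) t) atTop
      (𝓝 (SS b (p + 2) t)) := by simpa using h0.const_sub (SS b (p + 2) t)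
  refine h2.congr' ?_
  filter_upwards [eventually_ge_atTop (p + 1)] with N hN
  exact (h1 N hN).symm

lemma Li_one_eq {b : ℂ} (hb : ‖b‖ = 1) (hb1 : b ≠ 1) {t : ℝ} (ht : 0 ≤ t) :
    Li 1 (wf b t) = SS b 1 t := by
  have hd : ∀ s ∈ Ici t, HasDerivAt (fun s => Complex.log (1 - wf b s)) (gg b 1 s) s := by
    intro s hs
    have hs0 : 0 ≤ s := ht.trans hs
    have hw : HasDerivAt (wf b) (-wf b s) s := by
      unfold wf
      have h1 : HasDerivAt (fun u : ℝ => -(u : ℂ)) (-1) s := (Complex.ofRealCLM.hasDerivAt).neg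
      exact (h1.cexp.mul_const b).congr_deriv (by ring)
    have h2 := hw.const_sub 1
    have hsl : 1 - wf b s ∈ slitPlane := by
      left
      have hne := wf_ne hb hb1 s
      have hnorm : ‖wf b s‖ ≤ 1 := by rw [norm_wf hb]; simpa using hs0
      by_contra hcon
      simp only [Complex.sub_re, Complex.one_re, not_lt] at hcon
      have hre : (wf b s).re = 1 := by
        have := (Complex.re_le_norm (wf b s)); linarith
      have hsq := Complex.sq_norm (wf b s)
      rw [Complex.normSq_apply, hre] at hsq
      have him : (wf b s).im = 0 := by
        have h3 : ‖wf b s‖ ^ 2 ≤ 1 := by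
          have := norm_nonneg (wf b s); nlinarith
        nlinarith [sq_nonneg (wf b s).im]
      apply hne
      apply Complex.ext <;> simp [hre, him]
    convert h2.clog_real hsl using 1
    simp [gg]
  have hlim : Tendsto (fun s => Complex.log (1 - wf b s)) atTop (𝓝 0) := by
    have hw0 : Tendsto (wf b) atTop (𝓝 0) := by
      rw [tendsto_zero_iff_norm_tendsto_zero]
      simp_rw [norm_wf hb]
      exact Real.tendsto_exp_neg_atTop_nhds_zero
    have h1 : Tendsto (fun s => 1 - wf b s) atTop (𝓝 1) := by
      simpa using hw0.const_sub 1
    have h2 := (continuousAt_clog (x := 1) (by simp)).tendsto.comp h1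
    rw [Complex.log_one] at h2
    exact h2
  have := integral_Ioi_of_hasDerivAt_of_tendsto' hd (integrableOn_gg hb hb1 le_rfl t) hlim
  rw [SS, this, Li]
  ring

lemma norm_exp_mul (c : ℂ) (t : ℝ) : ‖Complex.exp (-c * t)‖ = Real.exp (-c.re * t) := by
  simp [Complex.norm_exp]

/-- integration by parts -/
lemma parts {b : ℂ} (hb : ‖b‖ = 1) (hb1 : b ≠ 1) {n : ℕ} (hn : 1 ≤ n) {c : ℂ} (hc : 0 < c.re) :
    IntegrableOn (fun t : ℝ => Complex.exp (-c * t) * SS b n t) (Ioi 0) ∧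
    -c * ∫ t in Ioi (0:ℝ), Complex.exp (-c * t) * SS b n t
      = (∫ t in Ioi (0:ℝ), Complex.exp (-c * t) * gg b n t) - SS b n 0 := by
  obtain ⟨K, hK0, hK⟩ := exists_kappa hb hb1
  have hn' : (1 : ℝ) ≤ n := by exact_mod_cast hn
  have hE : Continuous (fun t : ℝ => Complex.exp (-c * t)) := by fun_prop
  have hEi := (integrableOn_exp_mul_complex_Ioi (a := -c) (by simpa using hc) 0)
  have hSK : ∀ t : ℝ, 0 ≤ t → ‖SS b n t‖ ≤ K := fun t ht =>
    (norm_SS_le hb hK hn ht).trans (div_le_self hK0.le hn')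
  have hi1 : IntegrableOn (fun t : ℝ => Complex.exp (-c * t) * SS b n t) (Ioi 0) := by
    refine Integrable.mul_bdd (c := K) hEi (continuous_SS hb hb1 hn).aestronglyMeasurable ?_
    filter_upwards [ae_restrict_mem measurableSet_Ioi] with s hs
    exact hSK s (le_of_lt hs)
  have hi2 : IntegrableOn (fun t : ℝ => Complex.exp (-c * t) * gg b n t) (Ioi 0) := by
    refine Integrable.bdd_mul (c := 1) (integrableOn_gg hb hb1 hn 0) hE.aestronglyMeasurable ?_
    filter_upwards [ae_restrict_mem measurableSet_Ioi] with s hs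
    rw [norm_exp_mul, Real.exp_le_one_iff]
    have : (0:ℝ) < s := hs
    nlinarith
  refine ⟨hi1, ?_⟩
  have hd : ∀ t ∈ Ici (0:ℝ), HasDerivAt (fun t : ℝ => Complex.exp (-c * t) * SS b n t)
      (-c * (Complex.exp (-c * t) * SS b n t) - Complex.exp (-c * t) * gg b n t) t := by
    intro t _
    have h1 : HasDerivAt (fun u : ℝ => -c * (u : ℂ)) (-c * 1) t :=
      (Complex.ofRealCLM.hasDerivAt).const_mul (-c)
    exact (h1.cexp.mul (hasDerivAt_SS hb hb1 hn t)).congr_deriv (by ring)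
  have hlim : Tendsto (fun t : ℝ => Complex.exp (-c * t) * SS b n t) atTop (𝓝 0) := by
    refine squeeze_zero_norm' (a := fun t : ℝ => Real.exp (-c.re * t) * K) ?_ ?_
    · filter_upwards [eventually_ge_atTop 0] with t ht
      rw [norm_mul, norm_exp_mul]
      exact mul_le_mul_of_nonneg_left (hSK t ht) (Real.exp_pos _).le
    · have : Tendsto (fun t : ℝ => Real.exp (-c.re * t)) atTop (𝓝 0) := by
        rw [Real.tendsto_exp_comp_nhds_zero]
        exact tendsto_id.const_mul_atTop_of_neg (by linarith)
      simpa using this.mul_const K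
  have := integral_Ioi_of_hasDerivAt_of_tendsto' hd ((hi1.const_mul (-c)).sub hi2) hlim
  rw [integral_sub (hi1.const_mul (-c)) hi2, integral_const_mul] at this
  simp only [ofReal_zero, mul_zero, Complex.exp_zero, one_mul, zero_sub] at this
  linear_combination this

lemma summable_bdd {v : ℂ} (hv : ‖v‖ = 1) {m : ℕ} (hm : 1 ≤ m) {f : ℕ → ℂ} {K : ℝ}
    (hf : ∀ p, ‖f p‖ ≤ K) :
    Summable (fun p : ℕ => v ^ (p + 1) / ((p + 1 : ℕ) : ℂ) ^ (m + 1) * f p) := by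
  have hs : Summable (fun p : ℕ => 1 / (((p + 1 : ℕ) : ℝ)) ^ (m + 1) * K) :=
    (((summable_nat_add_iff 1).mpr
      (Real.summable_one_div_nat_pow.mpr (by omega : 1 < m + 1)))).mul_right K
  refine Summable.of_norm_bounded hs fun p => ?_
  rw [norm_mul, norm_div, norm_pow, hv, one_pow, norm_pow, Complex.norm_natCast]
  exact mul_le_mul_of_nonneg_left (hf p) (by positivity)

lemma key {b : ℂ} (hb : ‖b‖ = 1) (hb1 : b ≠ 1) {v : ℂ} (hv : ‖v‖ = 1) {m : ℕ} (hm : 1 ≤ m)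
    {y : ℂ} (hy : 0 < y.re) (n : ℕ → ℕ) (hn : ∀ p, 1 ≤ n p) :
    -y * ∫ t in Ioi (0:ℝ), ∑' p : ℕ,
        ((Complex.exp (-y * t) * v) ^ (p + 1) / ((p + 1 : ℕ) : ℂ) ^ m) * SS b (n p) t
      = (∑' p : ℕ, v ^ (p + 1) / ((p + 1 : ℕ) : ℂ) ^ (m + 1) *
          ∫ t in Ioi (0:ℝ), Complex.exp (-(y * (p + 1 : ℕ)) * t) * gg b (n p) t)
        - ∑' p : ℕ, v ^ (p + 1) / ((p + 1 : ℕ) : ℂ) ^ (m + 1) * SS b (n p) 0 := by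
  obtain ⟨K, hK0, hK⟩ := exists_kappa hb hb1
  have hSK : ∀ p, ∀ t : ℝ, 0 ≤ t → ‖SS b (n p) t‖ ≤ K := fun p t ht =>
    (norm_SS_le hb hK (hn p) ht).trans (div_le_self hK0.le (by exact_mod_cast hn p))
  have hre : ∀ p : ℕ, (y * (p + 1 : ℕ)).re = y.re * ((p + 1 : ℕ) : ℝ) := by
    intro p; rw [← Complex.ofReal_natCast, Complex.re_mul_ofReal]
  have hc : ∀ p : ℕ, 0 < (y * (p + 1 : ℕ)).re := by
    intro p; rw [hre]; positivity
  have hF : ∀ (p : ℕ) (t : ℝ),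
      ((Complex.exp (-y * t) * v) ^ (p + 1) / ((p + 1 : ℕ) : ℂ) ^ m) * SS b (n p) t
      = (v ^ (p + 1) / ((p + 1 : ℕ) : ℂ) ^ m) *
        (Complex.exp (-(y * (p + 1 : ℕ)) * t) * SS b (n p) t) := by
    intro p t
    rw [mul_pow, ← Complex.exp_nat_mul,
      show ((p + 1 : ℕ) : ℂ) * (-y * t) = -(y * (p + 1 : ℕ)) * t by ring]
    ring
  simp_rw [hF]
  have hbd : ∀ p : ℕ, ∫ t in Ioi (0:ℝ), ‖(v ^ (p + 1) / ((p + 1 : ℕ) : ℂ) ^ m) *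
        (Complex.exp (-(y * (p + 1 : ℕ)) * t) * SS b (n p) t)‖
        ≤ 1 / ((p + 1 : ℕ) : ℝ) ^ (m + 1) * (K / y.re) := by
    intro p
    have h1 : ∫ t in Ioi (0:ℝ), ‖(v ^ (p + 1) / ((p + 1 : ℕ) : ℂ) ^ m) *
        (Complex.exp (-(y * (p + 1 : ℕ)) * t) * SS b (n p) t)‖
        ≤ ∫ t in Ioi (0:ℝ), (1 / ((p + 1 : ℕ) : ℝ) ^ m * K) *
            Real.exp (-(y * (p + 1 : ℕ)).re * t) := by
      refine setIntegral_mono_on ?_ ?_ measurableSet_Ioi ?_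
      · exact ((parts hb hb1 (hn p) (hc p)).1.const_mul _).norm
      · exact (integrableOn_exp_mul_Ioi (by linarith [hc p]) 0).const_mul _
      · intro t ht
        rw [norm_mul, norm_mul, norm_exp_mul, norm_div, norm_pow, hv, one_pow, norm_pow,
          Complex.norm_natCast]
        calc _ ≤ 1 / ((p + 1 : ℕ) : ℝ) ^ m * (Real.exp (-(y * (p + 1 : ℕ)).re * t) * K) := by
              gcongr
              exact hSK p t (le_of_lt ht)
          _ = _ := by ring
    refine h1.trans (le_of_eq ?_)
    rw [integral_const_mul, integral_exp_mul_Ioi (by linarith [hc p]), hre]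
    have : ((p + 1 : ℕ) : ℝ) ≠ 0 := by positivity
    simp only [mul_zero, Real.exp_zero]
    field_simp
    ring
  have hsum : Summable fun p : ℕ => ∫ t in Ioi (0:ℝ), ‖(v ^ (p + 1) / ((p + 1 : ℕ) : ℂ) ^ m) *
        (Complex.exp (-(y * (p + 1 : ℕ)) * t) * SS b (n p) t)‖ := by
    refine Summable.of_nonneg_of_le (fun p => integral_nonneg fun t => norm_nonneg _) hbd ?_
    exact (((summable_nat_add_iff 1).mpr
      (Real.summable_one_div_nat_pow.mpr (by omega : 1 < m + 1)))).mul_right _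
  rw [← integral_tsum_of_summable_integral_norm
    (fun p => (parts hb hb1 (hn p) (hc p)).1.const_mul _) hsum, ← tsum_mul_left]
  have hterm : ∀ p : ℕ, -y * ∫ t in Ioi (0:ℝ), (v ^ (p + 1) / ((p + 1 : ℕ) : ℂ) ^ m) *
        (Complex.exp (-(y * (p + 1 : ℕ)) * t) * SS b (n p) t)
      = v ^ (p + 1) / ((p + 1 : ℕ) : ℂ) ^ (m + 1) *
          (∫ t in Ioi (0:ℝ), Complex.exp (-(y * (p + 1 : ℕ)) * t) * gg b (n p) t)
        - v ^ (p + 1) / ((p + 1 : ℕ) : ℂ) ^ (m + 1) * SS b (n p) 0 := by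
    intro p
    have hp : ((p + 1 : ℕ) : ℂ) ≠ 0 := by exact_mod_cast Nat.succ_ne_zero p
    rw [integral_const_mul, ← mul_sub, ← (parts hb hb1 (hn p) (hc p)).2, pow_succ (_ : ℂ) m]
    field_simp
  simp_rw [hterm]
  refine Summable.tsum_sub (summable_bdd hv hm (K := K) fun p => ?_)
    (summable_bdd hv hm (K := K) fun p => hSK p 0 le_rfl)
  have hn' : (1 : ℝ) ≤ n p := by exact_mod_cast hn p
  have h := norm_integral_le_of_norm_le (μ := volume.restrict (Ioi (0:ℝ)))
    (f := fun t : ℝ => Complex.exp (-(y * (p + 1 : ℕ)) * t) * gg b (n p) t)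
    ((integrableOn_exp_mul_Ioi (a := -(1 : ℝ)) (by norm_num) 0).const_mul K) (by
    filter_upwards [ae_restrict_mem measurableSet_Ioi] with s hs
    have hs : (0:ℝ) < s := hs
    rw [norm_mul, norm_exp_mul]
    have e1 : Real.exp (-(y * (p + 1 : ℕ)).re * s) ≤ 1 := by
      rw [Real.exp_le_one_iff]; nlinarith [hc p]
    have e2 : Real.exp (-(n p : ℝ) * s) ≤ Real.exp (-1 * s) := by
      rw [Real.exp_le_exp]; nlinarith
    calc _ ≤ 1 * ‖gg b (n p) s‖ := by gcongr
      _ ≤ K * Real.exp (-(n p : ℝ) * s) := by rw [one_mul]; exact norm_gg_le hb hK _ hs.le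
      _ ≤ _ := by gcongr)
  rw [integral_const_mul, integral_exp_mul_Ioi (by norm_num)] at h
  simpa using h

lemma norm_e2pi (θ : ℝ) : ‖e2pi θ‖ = 1 := by
  rw [e2pi, show (2 * Real.pi * Complex.I * θ : ℂ) = ((2 * Real.pi * θ : ℝ) : ℂ) * Complex.I by
    push_cast; ring, Complex.norm_exp_ofReal_mul_I]

lemma e2pi_ne_one_s19 {θ : ℝ} (h : ∀ n : ℤ, θ ≠ n) : e2pi θ ≠ 1 := by
  intro h1
  rw [e2pi, Complex.exp_eq_one_iff] at h1
  obtain ⟨n, hn⟩ := h1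
  apply h n
  have hpi : (2 * Real.pi * Complex.I : ℂ) ≠ 0 := Complex.two_pi_I_ne_zero
  have : (θ : ℂ) = (n : ℂ) := mul_left_cancel₀ hpi (by rw [hn]; ring)
  exact_mod_cast this

lemma Li_eq_tsum {m : ℕ} (hm : 1 ≤ m) {z : ℂ} (hz : ‖z‖ < 1) :
    Li m z = ∑' p : ℕ, z ^ (p + 1) / ((p + 1 : ℕ) : ℂ) ^ m := by
  match m, hm with
  | 1, _ =>
    have := (Complex.hasSum_taylorSeries_neg_log' hz).tsum_eq
    rw [Li, ← this]
    simp
  | (m + 2), _ => rw [Li]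

lemma main_aux (m : ℕ) (hm : 1 ≤ m) (a b : ℂ) (ha : ‖a‖ = 1) (hb : ‖b‖ = 1) (hb1 : b ≠ 1)
    (x : ℂ) (hx : 0 < x.re) :
    (-x) ^ 1 * ∫ t in Set.Ioi (0:ℝ), Li2 m 1 (Complex.exp (-x * t) * a) (Complex.exp (-(t : ℂ)) * b)
    = (-(x + 1) * ∫ t in Set.Ioi (0:ℝ),
        Li m (Complex.exp (-(x + 1) * t) * (a * b)) * Li 1 (Complex.exp (-(t : ℂ)) * b))
      + Li (m + 1) (a * b) * Li 1 b - Li2 (m + 1) 1 a b := by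
  have hw0 : wf b 0 = b := by simp [wf]
  have hx1 : 0 < (x + 1).re := by simp; linarith
  have hab : ‖a * b‖ = 1 := by simp [ha, hb]
  have e1 : ∫ t in Set.Ioi (0:ℝ),
      Li2 m 1 (Complex.exp (-x * t) * a) (Complex.exp (-(t : ℂ)) * b)
      = ∫ t in Ioi (0:ℝ), ∑' p : ℕ,
        ((Complex.exp (-x * t) * a) ^ (p + 1) / ((p + 1 : ℕ) : ℂ) ^ m) * SS b (p + 2) t := by
    refine setIntegral_congr_fun measurableSet_Ioi fun t ht => ?_
    simp only [Li2]
    refine tsum_congr fun p => ?_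
    rw [← limUnder_eq hb hb1 p (le_of_lt ht)]
    rfl
  have e2 : ∫ t in Set.Ioi (0:ℝ),
        Li m (Complex.exp (-(x + 1) * t) * (a * b)) * Li 1 (Complex.exp (-(t : ℂ)) * b)
      = ∫ t in Ioi (0:ℝ), ∑' p : ℕ,
        ((Complex.exp (-(x + 1) * t) * (a * b)) ^ (p + 1) / ((p + 1 : ℕ) : ℂ) ^ m) * SS b 1 t := by
    refine setIntegral_congr_fun measurableSet_Ioi fun t ht => ?_
    have ht' : (0:ℝ) < t := ht
    have h1 : Li 1 (Complex.exp (-(t : ℂ)) * b) = SS b 1 t := Li_one_eq hb hb1 ht'.le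
    rw [h1, Li_eq_tsum hm, tsum_mul_right]
    rw [norm_mul, hab, mul_one, norm_exp_mul, Real.exp_lt_one_iff]
    nlinarith
  have e3 : Li (m + 1) (a * b) * Li 1 b
      = ∑' p : ℕ, (a * b) ^ (p + 1) / ((p + 1 : ℕ) : ℂ) ^ (m + 1) * SS b 1 0 := by
    rw [tsum_mul_right, ← Li_one_eq hb hb1 le_rfl, hw0]
    obtain ⟨j, rfl⟩ : ∃ j, m = j + 1 := ⟨m - 1, by omega⟩
    rw [show j + 1 + 1 = j + 2 from rfl]
    rfl
  have e4 : Li2 (m + 1) 1 a b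
      = ∑' p : ℕ, a ^ (p + 1) / ((p + 1 : ℕ) : ℂ) ^ (m + 1) * SS b (p + 2) 0 := by
    simp only [Li2]
    refine tsum_congr fun p => ?_
    rw [← limUnder_eq hb hb1 p le_rfl, hw0]
  have k1 := key hb hb1 ha hm hx (fun p => p + 2) (fun p => by omega)
  have k2 := key hb hb1 hab hm hx1 (fun _ => 1) (fun p => le_rfl)
  have e5 : ∀ p : ℕ, a ^ (p + 1) / ((p + 1 : ℕ) : ℂ) ^ (m + 1) *
          ∫ t in Ioi (0:ℝ), Complex.exp (-(x * (p + 1 : ℕ)) * t) * gg b (p + 2) t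
      = (a * b) ^ (p + 1) / ((p + 1 : ℕ) : ℂ) ^ (m + 1) *
          ∫ t in Ioi (0:ℝ), Complex.exp (-((x + 1) * (p + 1 : ℕ)) * t) * gg b 1 t := by
    intro p
    rw [← integral_const_mul, ← integral_const_mul]
    congr 1
    funext t
    have : Complex.exp (-((x + 1) * (p + 1 : ℕ)) * t)
        = Complex.exp (-(x * (p + 1 : ℕ)) * t) * Complex.exp (-(t : ℂ)) ^ (p + 1) := by
      rw [← Complex.exp_nat_mul, ← Complex.exp_add]
      congr 1; ring
    rw [this, gg, gg, show p + 2 = (p + 1) + 1 from rfl, pow_succ (wf b t) (p + 1), wf]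
    ring
  rw [e1, e2, e3, e4, pow_one, k1, k2]
  simp only [e5]
  ring

/-- For `k ≥ 3`, `G_{k-2,1}(x,α,β) = F_k(x+1, α+β, β) + Li_{k-1}(e^{2πi(α+β)}) Li₁(e^{2πiβ})
- Li_{k-1,1}(e^{2πiα}, e^{2πiβ})`. -/
theorem Gmn_eq_Fk (k : ℕ) (hk : 3 ≤ k) (α β : ℝ)
    (hα : ∀ n : ℤ, α ≠ n) (hβ : ∀ n : ℤ, β ≠ n) (x : ℂ) (hx : 0 < x.re) :
    Gmn (k - 2) 1 x α β
      = Fk k (x + 1) (α + β) β + Li (k - 1) (e2pi (α + β)) * Li 1 (e2pi β) -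
          Li2 (k - 1) 1 (e2pi α) (e2pi β) := by
  have hadd : e2pi (α + β) = e2pi α * e2pi β := by
    simp only [e2pi]
    rw [← Complex.exp_add]
    congr 1
    push_cast
    ring
  obtain ⟨m, rfl⟩ : ∃ m, k = m + 2 := ⟨k - 2, by omega⟩
  have h := main_aux m (by omega) (e2pi α) (e2pi β) (norm_e2pi α) (norm_e2pi β)
    (e2pi_ne_one_s19 hβ) x hx
  rw [show m + 2 - 1 = m + 1 from rfl, Gmn, Fk, show m + 2 - 2 = m from rfl, hadd]
  exact h

end
end
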